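/- For every interval (p,q) ∈ E and every n ∈ ℤ, the family (Λ((p,q),m)·L(m,n))_{m∈ℤ} is summable and Σ_{m∈ℤ} Λ((p,q),m) L(m,n) = μ(n)·[ b_n(1_{n=p−1} − 1_{n=q}) + a_n(1_{n=q+1} − 1_{n=p}) ] / μ(⟦p,q⟧), where indicators involving an infinite endpoint are 0; moreover this same value equals the dual-side sum a'_{p,q}·Λ((p−1,q),n) + b_{p,q}·Λ((p,q+1),n) + b'_{p,q}·Λ((p+1,q),n) + a_{p,q}·Λ((p,q−1),n) − (a'_{p,q}+b_{p,q}+b'_{p,q}+a_{p,q})·Λ((p,q),n), where any term whose interval is empty vanishes. In other words, (ΛL)_{(p,q),n} = (L*Λ)_{(p,q),n}. -/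

import Mathlib

open scoped BigOperators

attribute [local instance] Classical.propDecidable

/-- `μ(⟦p,q⟧)`, the stationary mass of the (possibly infinite) interval `⟦p,q⟧ ⊆ ℤ`. -/
noncomputable def muI (μ : ℤ → ℝ) (p : WithBot ℤ) (q : WithTop ℤ) : ℝ :=
  ∑' n : {n : ℤ // p ≤ (n : WithBot ℤ) ∧ (n : WithTop ℤ) ≤ q}, μ (n : ℤ)

/-- The kernel `Λ((p,q),n) = 1_{n∈⟦p,q⟧}·μ(n)/μ(⟦p,q⟧)`. -/
noncomputable def lamI (μ : ℤ → ℝ) (p : WithBot ℤ) (q : WithTop ℤ) (n : ℤ) : ℝ :=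
  if p ≤ (n : WithBot ℤ) ∧ (n : WithTop ℤ) ≤ q then μ n / muI μ p q else 0

/-- The birth-death generator on `ℤ` with death rates `a` and birth rates `b`. -/
noncomputable def bdGen (a b : ℤ → ℝ) (i j : ℤ) : ℝ :=
  if j = i + 1 then b i
  else if j = i - 1 then a i
  else if j = i then -(a i + b i)
  else 0

/-- Extension of a rate function to `ℤ ∪ {−∞}` by the convention `a_{−∞} = 0`. -/
noncomputable def rateBot (a : ℤ → ℝ) : WithBot ℤ → ℝ :=
  fun p => WithBot.recBotCoe 0 a p

/-- Extension of a rate function to `ℤ ∪ {+∞}` by the convention `a_{+∞} = 0`. -/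
noncomputable def rateTop (a : ℤ → ℝ) : WithTop ℤ → ℝ :=
  fun q => WithTop.recTopCoe 0 a q

/-- The dual rate `a'_{p,q}` toward `(p−1,q)`. -/
noncomputable def dualAp (μ a b : ℤ → ℝ) (p : WithBot ℤ) (q : WithTop ℤ) : ℝ :=
  (muI μ (p + ((-1 : ℤ) : WithBot ℤ)) q / muI μ p q) * rateBot b (p + ((-1 : ℤ) : WithBot ℤ))

/-- The dual rate `b_{p,q}` toward `(p,q+1)`. -/
noncomputable def dualB (μ a b : ℤ → ℝ) (p : WithBot ℤ) (q : WithTop ℤ) : ℝ :=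
  (muI μ p (q + ((1 : ℤ) : WithTop ℤ)) / muI μ p q) * rateTop a (q + ((1 : ℤ) : WithTop ℤ))

/-- The dual rate `b'_{p,q}` toward `(p+1,q)` (it vanishes if `⟦p+1,q⟧` is empty, since then
`μ(⟦p+1,q⟧) = 0`). -/
noncomputable def dualBp (μ a b : ℤ → ℝ) (p : WithBot ℤ) (q : WithTop ℤ) : ℝ :=
  (muI μ (p + ((1 : ℤ) : WithBot ℤ)) q / muI μ p q) * rateBot a p

/-- The dual rate `a_{p,q}` toward `(p,q−1)` (it vanishes if `⟦p,q−1⟧` is empty). -/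
noncomputable def dualA (μ a b : ℤ → ℝ) (p : WithBot ℤ) (q : WithTop ℤ) : ℝ :=
  (muI μ p (q + ((-1 : ℤ) : WithTop ℤ)) / muI μ p q) * rateTop b q

theorem muI_eq (μ : ℤ → ℝ) (p : WithBot ℤ) (q : WithTop ℤ) :
    muI μ p q = ∑' n : ℤ, if p ≤ (n : WithBot ℤ) ∧ (n : WithTop ℤ) ≤ q then μ n else 0 := by
  unfold muI
  have := tsum_subtype {n : ℤ | p ≤ (n : WithBot ℤ) ∧ (n : WithTop ℤ) ≤ q} μ
  refine Eq.trans this ?_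
  congr 1
  ext n
  simp [Set.indicator_apply]

theorem summ_ite (μ : ℤ → ℝ) (hs : Summable μ) (P : ℤ → Prop) [DecidablePred P] :
    Summable (fun n : ℤ => if P n then μ n else 0) := by
  have := hs.indicator {n | P n}
  refine this.congr ?_
  intro n
  simp [Set.indicator_apply]

theorem muI_pos (μ : ℤ → ℝ) (hs : Summable μ) (hμ : ∀ n, 0 < μ n) (p : WithBot ℤ) (q : WithTop ℤ)
    (n : ℤ) (h : p ≤ (n : WithBot ℤ) ∧ (n : WithTop ℤ) ≤ q) : 0 < muI μ p q := by
  rw [muI_eq]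
  refine (summ_ite μ hs _).tsum_pos ?_ n ?_
  · intro i
    split_ifs
    · exact (hμ i).le
    · exact le_rfl
  · rw [if_pos h]; exact hμ n

theorem muI_left (μ : ℤ → ℝ) (hs : Summable μ) (k : ℤ) (q : WithTop ℤ)
    (h : (k : WithTop ℤ) ≤ q) :
    muI μ (k : WithBot ℤ) q = μ k + muI μ ((k + 1 : ℤ) : WithBot ℤ) q := by
  rw [muI_eq, muI_eq, (summ_ite μ hs _).tsum_eq_add_tsum_ite k]
  congr 1
  · simp [h]
  · congr 1
    ext n
    simp only [WithBot.coe_le_coe]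
    by_cases h1 : (n : WithTop ℤ) ≤ q <;> simp only [h1, and_true, and_false, if_false, ite_self]
    split_ifs <;> first | rfl | omega

theorem muI_right (μ : ℤ → ℝ) (hs : Summable μ) (k : ℤ) (p : WithBot ℤ)
    (h : p ≤ (k : WithBot ℤ)) :
    muI μ p (k : WithTop ℤ) = μ k + muI μ p ((k - 1 : ℤ) : WithTop ℤ) := by
  rw [muI_eq, muI_eq, (summ_ite μ hs _).tsum_eq_add_tsum_ite k]
  congr 1
  · simp [h]
  · congr 1
    ext n
    simp only [WithTop.coe_le_coe]
    by_cases h1 : p ≤ (n : WithBot ℤ) <;>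
      simp only [h1, true_and, false_and, if_false, ite_self]
    split_ifs <;> first | rfl | omega

/-- a rate toward an interval times the kernel of that interval -/
theorem rate_lam (μ : ℤ → ℝ) (hs : Summable μ) (hμ : ∀ n, 0 < μ n) (p : WithBot ℤ) (q : WithTop ℤ)
    (n : ℤ) (M r : ℝ) :
    muI μ p q / M * r * lamI μ p q n
      = μ n / M * r * (if p ≤ (n : WithBot ℤ) ∧ (n : WithTop ℤ) ≤ q then 1 else 0) := by
  unfold lamI
  split_ifs with h
  · have := (muI_pos μ hs hμ p q n h).ne'
    field_simp
  · simp

theorem lam_eq (μ : ℤ → ℝ) (p : WithBot ℤ) (q : WithTop ℤ) (n : ℤ) :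
    lamI μ p q n
      = μ n / muI μ p q * (if p ≤ (n : WithBot ℤ) ∧ (n : WithTop ℤ) ≤ q then 1 else 0) := by
  unfold lamI
  split_ifs <;> simp

theorem left_side (a b μ : ℤ → ℝ) (hμ : ∀ n, 0 < μ n) (hs : Summable μ)
    (hdb : ∀ n : ℤ, μ n * b n = μ (n + 1) * a (n + 1))
    (p : WithBot ℤ) (q : WithTop ℤ)
    (hpq : ∃ n : ℤ, p ≤ (n : WithBot ℤ) ∧ (n : WithTop ℤ) ≤ q) (n : ℤ) :
    dualAp μ a b p q * lamI μ (p + ((-1 : ℤ) : WithBot ℤ)) q n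
      + dualBp μ a b p q * lamI μ (p + ((1 : ℤ) : WithBot ℤ)) q n
      - (dualAp μ a b p q + dualBp μ a b p q) * lamI μ p q n
    = μ n / muI μ p q * (b n * (if (n : WithBot ℤ) = p + ((-1 : ℤ) : WithBot ℤ) then (1 : ℝ) else 0)
        - a n * (if (n : WithBot ℤ) = p then (1 : ℝ) else 0)) := by
  obtain ⟨m, hm⟩ := hpq
  have hM := (muI_pos μ hs hμ p q m hm).ne'
  induction p using WithBot.recBotCoe with
  | bot => simp [dualAp, dualBp, rateBot]
  | coe k =>
    have hkm : k ≤ m := by simpa using hm.1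
    have hk : (k : WithTop ℤ) ≤ q := le_trans (by exact_mod_cast hkm) hm.2
    have hk' : ((k - 1 : ℤ) : WithTop ℤ) ≤ q := le_trans (by exact_mod_cast (by omega)) hk
    have e1 : (k : WithBot ℤ) + ((-1 : ℤ) : WithBot ℤ) = ((k - 1 : ℤ) : WithBot ℤ) := by
      rw [← WithBot.coe_add]; rfl
    have e2 : (k : WithBot ℤ) + ((1 : ℤ) : WithBot ℤ) = ((k + 1 : ℤ) : WithBot ℤ) := by
      rw [← WithBot.coe_add]
    have hd := hdb (k - 1)
    have m1 := muI_left μ hs (k - 1) q hk'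
    have m2 := muI_left μ hs k q hk
    simp only [sub_add_cancel] at hd m1
    have hr : dualAp μ a b k q + dualBp μ a b k q = b (k - 1) + a k := by
      simp only [dualAp, dualBp, e1, e2, rateBot, WithBot.recBotCoe_coe]
      field_simp
      rw [m1]
      have : muI μ ((k + 1 : ℤ) : WithBot ℤ) q = muI μ (k : WithBot ℤ) q - μ k := by linarith
      rw [this]
      linear_combination hd
    rw [hr]
    simp only [dualAp, dualBp, e1, e2, rateBot, WithBot.recBotCoe_coe]
    rw [rate_lam μ hs hμ, rate_lam μ hs hμ, lam_eq]
    simp only [WithBot.coe_le_coe, WithBot.coe_inj]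
    by_cases h1 : (n : WithTop ℤ) ≤ q
    · simp only [h1, and_true]
      rcases lt_trichotomy n (k - 1) with h | h | h
      · simp [show ¬ k - 1 ≤ n by omega, show ¬ k + 1 ≤ n by omega, show ¬ k ≤ n by omega,
          show ¬ n = k - 1 by omega, show ¬ n = k by omega]
      · subst h
        simp [show ¬ k + 1 ≤ k - 1 by omega]
      · rcases eq_or_ne n k with h' | h'
        · subst h'
          simp [show ¬ n = n - 1 by omega]
          ring
        · simp [show k - 1 ≤ n by omega, show k + 1 ≤ n by omega, show k ≤ n by omega,
            show ¬ n = k - 1 by omega, h']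
          ring
    · have g1 : n ≠ k := by rintro rfl; exact h1 hk
      have g2 : n ≠ k - 1 := by rintro rfl; exact h1 hk'
      simp [h1, g1, g2]

theorem right_side (a b μ : ℤ → ℝ) (hμ : ∀ n, 0 < μ n) (hs : Summable μ)
    (hdb : ∀ n : ℤ, μ n * b n = μ (n + 1) * a (n + 1))
    (p : WithBot ℤ) (q : WithTop ℤ)
    (hpq : ∃ n : ℤ, p ≤ (n : WithBot ℤ) ∧ (n : WithTop ℤ) ≤ q) (n : ℤ) :
    dualB μ a b p q * lamI μ p (q + ((1 : ℤ) : WithTop ℤ)) n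
      + dualA μ a b p q * lamI μ p (q + ((-1 : ℤ) : WithTop ℤ)) n
      - (dualB μ a b p q + dualA μ a b p q) * lamI μ p q n
    = μ n / muI μ p q * (a n * (if (n : WithTop ℤ) = q + ((1 : ℤ) : WithTop ℤ) then (1 : ℝ) else 0)
        - b n * (if (n : WithTop ℤ) = q then (1 : ℝ) else 0)) := by
  obtain ⟨m, hm⟩ := hpq
  have hM := (muI_pos μ hs hμ p q m hm).ne'
  induction q using WithTop.recTopCoe with
  | top => simp [dualA, dualB, rateTop]
  | coe k =>
    have hkm : m ≤ k := by simpa using hm.2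
    have hk : p ≤ (k : WithBot ℤ) := le_trans hm.1 (by exact_mod_cast hkm)
    have hk' : p ≤ ((k + 1 : ℤ) : WithBot ℤ) :=
      le_trans hk (WithBot.coe_le_coe.2 (by omega))
    have e1 : (k : WithTop ℤ) + ((-1 : ℤ) : WithTop ℤ) = ((k - 1 : ℤ) : WithTop ℤ) := by
      rw [← WithTop.coe_add]; rfl
    have e2 : (k : WithTop ℤ) + ((1 : ℤ) : WithTop ℤ) = ((k + 1 : ℤ) : WithTop ℤ) := by
      rw [← WithTop.coe_add]
    have hd := hdb k
    have m1 := muI_right μ hs (k + 1) p hk'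
    have m2 := muI_right μ hs k p hk
    simp only [add_sub_cancel_right] at m1
    have hr : dualB μ a b p k + dualA μ a b p k = a (k + 1) + b k := by
      simp only [dualA, dualB, e1, e2, rateTop, WithTop.recTopCoe_coe]
      field_simp
      rw [m1]
      have : muI μ p ((k - 1 : ℤ) : WithTop ℤ) = muI μ p (k : WithTop ℤ) - μ k := by linarith
      rw [this]
      linear_combination -hd
    rw [hr]
    simp only [dualA, dualB, e1, e2, rateTop, WithTop.recTopCoe_coe]
    rw [rate_lam μ hs hμ, rate_lam μ hs hμ, lam_eq]
    simp only [WithTop.coe_le_coe, WithTop.coe_inj]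
    by_cases h1 : p ≤ (n : WithBot ℤ)
    · simp only [h1, true_and]
      rcases lt_trichotomy n (k + 1) with h | h | h
      · rcases eq_or_ne n k with h' | h'
        · subst h'
          simp
          ring
        · simp [show n ≤ k - 1 by omega, show n ≤ k + 1 by omega, show n ≤ k by omega,
            show ¬ n = k + 1 by omega, h']
          ring
      · subst h
        simp [show ¬ k + 1 ≤ k - 1 by omega]
      · simp [show ¬ n ≤ k - 1 by omega, show ¬ n ≤ k + 1 by omega, show ¬ n ≤ k by omega,
          show ¬ n = k + 1 by omega, show ¬ n = k by omega]
    · have g1 : n ≠ k := by rintro rfl; exact h1 hk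
      have g2 : n ≠ k + 1 := by rintro rfl; exact h1 hk'
      simp [h1, g1, g2]

theorem ind_up (p : WithBot ℤ) (q : WithTop ℤ)
    (hpq : ∃ n : ℤ, p ≤ (n : WithBot ℤ) ∧ (n : WithTop ℤ) ≤ q) (n : ℤ) :
    (if p ≤ ((n + 1 : ℤ) : WithBot ℤ) ∧ ((n + 1 : ℤ) : WithTop ℤ) ≤ q then (1 : ℝ) else 0)
      - (if p ≤ (n : WithBot ℤ) ∧ (n : WithTop ℤ) ≤ q then (1 : ℝ) else 0)
    = (if (n : WithBot ℤ) = p + ((-1 : ℤ) : WithBot ℤ) then (1 : ℝ) else 0)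
      - (if (n : WithTop ℤ) = q then (1 : ℝ) else 0) := by
  obtain ⟨m, h1, h2⟩ := hpq
  induction p using WithBot.recBotCoe with
  | bot =>
    induction q using WithTop.recTopCoe with
    | top => simp
    | coe l =>
      simp only [bot_le, true_and, WithTop.coe_le_coe, WithTop.coe_inj, WithBot.bot_add,
        WithBot.coe_ne_bot, if_false] at *
      split_ifs <;> first | (exfalso; omega) | norm_num
  | coe k =>
    simp only [← WithBot.coe_add, WithBot.coe_le_coe, WithBot.coe_inj] at *
    induction q using WithTop.recTopCoe with
    | top =>
      simp only [le_top, and_true, WithTop.coe_ne_top, if_false] at *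
      split_ifs <;> first | (exfalso; omega) | norm_num
    | coe l =>
      simp only [WithTop.coe_le_coe, WithTop.coe_inj] at *
      split_ifs <;> first | (exfalso; omega) | norm_num

theorem ind_down (p : WithBot ℤ) (q : WithTop ℤ)
    (hpq : ∃ n : ℤ, p ≤ (n : WithBot ℤ) ∧ (n : WithTop ℤ) ≤ q) (n : ℤ) :
    (if p ≤ ((n - 1 : ℤ) : WithBot ℤ) ∧ ((n - 1 : ℤ) : WithTop ℤ) ≤ q then (1 : ℝ) else 0)
      - (if p ≤ (n : WithBot ℤ) ∧ (n : WithTop ℤ) ≤ q then (1 : ℝ) else 0)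
    = (if (n : WithTop ℤ) = q + ((1 : ℤ) : WithTop ℤ) then (1 : ℝ) else 0)
      - (if (n : WithBot ℤ) = p then (1 : ℝ) else 0) := by
  obtain ⟨m, h1, h2⟩ := hpq
  induction p using WithBot.recBotCoe with
  | bot =>
    induction q using WithTop.recTopCoe with
    | top => simp
    | coe l =>
      simp only [bot_le, true_and, ← WithTop.coe_add, WithTop.coe_le_coe, WithTop.coe_inj,
        WithBot.coe_ne_bot, if_false] at *
      split_ifs <;> first | (exfalso; omega) | norm_num
  | coe k =>
    simp only [WithBot.coe_le_coe, WithBot.coe_inj] at *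
    induction q using WithTop.recTopCoe with
    | top =>
      simp only [le_top, and_true, WithTop.top_add, WithTop.coe_ne_top, if_false] at *
      split_ifs <;> first | (exfalso; omega) | norm_num
    | coe l =>
      simp only [← WithTop.coe_add, WithTop.coe_le_coe, WithTop.coe_inj] at *
      split_ifs <;> first | (exfalso; omega) | norm_num

/-- For every interval `(p,q)` and every `n ∈ ℤ`, the family `(Λ((p,q),m)·L(m,n))_{m∈ℤ}` is
summable, its sum equals
`μ(n)·[b_n(1_{n=p−1} − 1_{n=q}) + a_n(1_{n=q+1} − 1_{n=p})]/μ(⟦p,q⟧)` (indicators involving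
an infinite endpoint being `0`), and this same value equals the dual-side sum: in other words
`(ΛL)_{(p,q),n} = (L*Λ)_{(p,q),n}`. -/
theorem dual_intertwining_birth_death (a b μ : ℤ → ℝ)
    (ha : ∀ n, 0 < a n) (hb : ∀ n, 0 < b n) (hμ : ∀ n, 0 < μ n)
    (hsum : Summable μ) (hone : ∑' n, μ n = 1)
    (hdb : ∀ n : ℤ, μ n * b n = μ (n + 1) * a (n + 1))
    (p : WithBot ℤ) (q : WithTop ℤ)
    (hpq : ∃ n : ℤ, p ≤ (n : WithBot ℤ) ∧ (n : WithTop ℤ) ≤ q)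
    (n : ℤ) :
    Summable (fun m : ℤ => lamI μ p q m * bdGen a b m n) ∧
    (∑' m : ℤ, lamI μ p q m * bdGen a b m n)
      = μ n * (b n * ((if (n : WithBot ℤ) = p + ((-1 : ℤ) : WithBot ℤ) then (1 : ℝ) else 0)
              - (if (n : WithTop ℤ) = q then (1 : ℝ) else 0))
          + a n * ((if (n : WithTop ℤ) = q + ((1 : ℤ) : WithTop ℤ) then (1 : ℝ) else 0)
              - (if (n : WithBot ℤ) = p then (1 : ℝ) else 0))) / muI μ p q ∧
    (∑' m : ℤ, lamI μ p q m * bdGen a b m n)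
      = dualAp μ a b p q * lamI μ (p + ((-1 : ℤ) : WithBot ℤ)) q n
        + dualB μ a b p q * lamI μ p (q + ((1 : ℤ) : WithTop ℤ)) n
        + dualBp μ a b p q * lamI μ (p + ((1 : ℤ) : WithBot ℤ)) q n
        + dualA μ a b p q * lamI μ p (q + ((-1 : ℤ) : WithTop ℤ)) n
        - (dualAp μ a b p q + dualB μ a b p q + dualBp μ a b p q + dualA μ a b p q)
            * lamI μ p q n := by
  have hz : ∀ m ∉ ({n - 1, n, n + 1} : Finset ℤ), lamI μ p q m * bdGen a b m n = 0 := by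
    intro m hm
    simp only [Finset.mem_insert, Finset.mem_singleton, not_or] at hm
    have : bdGen a b m n = 0 := by
      unfold bdGen
      rw [if_neg (by omega), if_neg (by omega), if_neg (by omega)]
    rw [this, mul_zero]
  have hS : (∑' m : ℤ, lamI μ p q m * bdGen a b m n)
      = μ n * (b n * ((if (n : WithBot ℤ) = p + ((-1 : ℤ) : WithBot ℤ) then (1 : ℝ) else 0)
              - (if (n : WithTop ℤ) = q then (1 : ℝ) else 0))
          + a n * ((if (n : WithTop ℤ) = q + ((1 : ℤ) : WithTop ℤ) then (1 : ℝ) else 0)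
              - (if (n : WithBot ℤ) = p then (1 : ℝ) else 0))) / muI μ p q := by
    rw [tsum_eq_sum hz, Finset.sum_insert (by simp; omega), Finset.sum_insert (by simp),
      Finset.sum_singleton, ← ind_up p q hpq n, ← ind_down p q hpq n]
    have b1 : bdGen a b (n - 1) n = b (n - 1) := by
      unfold bdGen
      rw [if_pos (by omega)]
    have b2 : bdGen a b n n = -(a n + b n) := by
      unfold bdGen
      rw [if_neg (by omega), if_neg (by omega), if_pos rfl]
    have b3 : bdGen a b (n + 1) n = a (n + 1) := by
      unfold bdGen
      rw [if_neg (by omega), if_pos (by omega)]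
    rw [b1, b2, b3, lam_eq, lam_eq, lam_eq]
    have h1 := hdb (n - 1)
    have h2 := hdb n
    rw [sub_add_cancel] at h1
    generalize (if p ≤ ((n - 1 : ℤ) : WithBot ℤ) ∧ ((n - 1 : ℤ) : WithTop ℤ) ≤ q
      then (1 : ℝ) else 0) = x
    generalize (if p ≤ ((n + 1 : ℤ) : WithBot ℤ) ∧ ((n + 1 : ℤ) : WithTop ℤ) ≤ q
      then (1 : ℝ) else 0) = y
    linear_combination (x / muI μ p q) * h1 - (y / muI μ p q) * h2
  refine ⟨summable_of_ne_finset_zero hz, hS, ?_⟩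
  rw [hS]
  have hl := left_side a b μ hμ hsum hdb p q hpq n
  have hr := right_side a b μ hμ hsum hdb p q hpq n
  linear_combination -hl - hr
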